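/- For d = 5, the Poincaré series of the algebra of covariants of the binary 5-form satisfies P_5(z) = p_5(z)/((1 − z)(1 − z²)(1 − z⁴)(1 − z⁶)(1 − z⁸)), where p_5(z) = z^{15} + z^{13} + 3z^{12} + 3z^{11} + 5z^{10} + 4z^9 + 6z^8 + 6z^7 + 4z^6 + 5z^5 + 3z^4 + 3z^3 + z^2 + 1; i.e. ∑_{n≥0} dim(S_n) z^n = p_5(z) · ((1 − z)(1 − z²)(1 − z⁴)(1 − z⁶)(1 − z⁸))^{−1} in ℂ[[z]]. -/

import Mathlib

noncomputable section

/-- The derivation D₁ on ℂ[x_0,…,x_d] with D₁(x_0)=0 and D₁(x_i)=i·x_{i-1}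
(for i = 0 the coefficient i vanishes, so the wrap-around in `Fin` is harmless). -/
def D1 (d : ℕ) :
    Derivation ℂ (MvPolynomial (Fin (d + 1)) ℂ) (MvPolynomial (Fin (d + 1)) ℂ) :=
  MvPolynomial.mkDerivation ℂ (fun i => (i.val : ℂ) • MvPolynomial.X (i - 1))

/-- S_n: the space of homogeneous degree-n seminvariants of the binary d-form. -/
def Sn (d n : ℕ) : Submodule ℂ (MvPolynomial (Fin (d + 1)) ℂ) :=
  MvPolynomial.homogeneousSubmodule (Fin (d + 1)) ℂ n ⊓ LinearMap.ker (D1 d).toLinearMap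

/-- The Poincaré series P_d(z) = ∑_{n≥0} dim(S_n) zⁿ of the algebra of covariants. -/
def PSeries (d : ℕ) : PowerSeries ℂ :=
  PowerSeries.mk fun n => (Module.finrank ℂ (Sn d n) : ℂ)

section SlTwo

variable {V : Type*} [AddCommGroup V] [Module ℂ V] {e f h : V →ₗ[ℂ] V}

theorem pow_apply_eigenvector (hhe : ∀ v, h (e v) = e (h v) + (2 : ℂ) • e v)
    {μ : ℂ} {v : V} (hv : h v = μ • v) (N : ℕ) :
    h ((e ^ N) v) = (μ + 2 * N) • (e ^ N) v := by
  induction N with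
  | zero => simp [hv]
  | succ N ih =>
    rw [pow_succ', Module.End.mul_apply, hhe, ih, map_smul, ← add_smul]
    congr 1
    push_cast
    ring

theorem pow_succ_apply_comm (hef : ∀ v, e (f v) = f (e v) + h v)
    (hhe : ∀ v, h (e v) = e (h v) + (2 : ℂ) • e v)
    {μ : ℂ} {v : V} (hv : h v = μ • v) (N : ℕ) :
    (e ^ (N + 1)) (f v) = f ((e ^ (N + 1)) v) + ((N + 1) * (μ + N)) • (e ^ N) v := by
  induction N with
  | zero => simp [hef, hv]
  | succ N ih =>
    rw [pow_succ', Module.End.mul_apply, ih, map_add, map_smul, hef,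
      pow_apply_eigenvector hhe hv, ← Module.End.mul_apply e, ← pow_succ', ← Module.End.mul_apply e,
      ← pow_succ', add_assoc, ← add_smul]
    congr 2
    push_cast
    ring

theorem eq_zero_of_pow_apply_eq_zero (hef : ∀ v, e (f v) = f (e v) + h v)
    (hhe : ∀ v, h (e v) = e (h v) + (2 : ℂ) • e v)
    {μ : ℂ} (hμ : ∀ N : ℕ, μ + N ≠ 0) {v : V} (hv : h v = μ • v) (hf : f v = 0)
    {N : ℕ} (hN : (e ^ N) v = 0) : v = 0 := by
  induction N with
  | zero => simpa using hN
  | succ N ih =>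
    apply ih
    have key := pow_succ_apply_comm hef hhe hv N
    rw [hf, hN, map_zero, map_zero, zero_add] at key
    exact (smul_eq_zero.1 key.symm).resolve_left
      (mul_ne_zero (by exact_mod_cast N.succ_ne_zero) (hμ N))

theorem exists_apply_apply_eq_of_pow_apply_eq_zero (hef : ∀ v, e (f v) = f (e v) + h v)
    (hhe : ∀ v, h (e v) = e (h v) + (2 : ℂ) • e v)
    {μ : ℂ} (hμ : ∀ N : ℕ, μ + N ≠ 0) {P : Submodule ℂ V} (hP : ∀ v ∈ P, h v = μ • v)
    (hPef : ∀ v ∈ P, e (f v) ∈ P) {v : V} (hv : v ∈ P) {N : ℕ} (hN : (e ^ N) v = 0) :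
    ∃ u ∈ P, e (f u) = v := by
  induction N generalizing v with
  | zero => exact ⟨0, P.zero_mem, by simpa using hN.symm⟩
  | succ N ih =>
    set c : ℂ := (N + 1) * (μ + N) with hc
    have hc0 : c ≠ 0 := mul_ne_zero (by exact_mod_cast N.succ_ne_zero) (hμ N)
    obtain ⟨u, hu, hu'⟩ := ih (v := v - c⁻¹ • e (f v)) (P.sub_mem hv (P.smul_mem _ (hPef v hv))) (by
      have key := pow_succ_apply_comm hef hhe (hP v hv) N
      rw [hN, map_zero, zero_add, pow_succ, Module.End.mul_apply, ← hc] at key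
      rw [map_sub, map_smul, key, smul_smul, inv_mul_cancel₀ hc0, one_smul, sub_self])
    refine ⟨u + c⁻¹ • v, P.add_mem hu (P.smul_mem _ hv), ?_⟩
    rw [map_add, map_add, hu', map_smul, map_smul, sub_add_cancel]

end SlTwo

section WeightedDerivation

open MvPolynomial

variable {σ R M : Type*} [CommRing R] [AddCommGroup M] {w : σ → M}

theorem isWeightedHomogeneous_mkDerivation {g : σ → MvPolynomial σ R} {δ : M}
    (hg : ∀ i, IsWeightedHomogeneous w (g i) (w i + δ)) {p : MvPolynomial σ R} {m : M}
    (hp : IsWeightedHomogeneous w p m) :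
    IsWeightedHomogeneous w (mkDerivation R g p) (m + δ) := by
  classical
  rw [p.as_sum, map_sum]
  refine (weightedHomogeneousSubmodule R w (m + δ)).sum_mem fun s hs => ?_
  rw [mkDerivation_monomial]
  refine Submodule.smul_mem _ _ (Submodule.sum_mem _ fun i hi => ?_)
  have h1 : Finsupp.weight w (s - Finsupp.single i 1) + w i = m := by
    rw [← hp (mem_support_iff.1 hs)]
    conv_rhs => rw [← tsub_add_cancel_of_le (Finsupp.single_le_iff.2
      (Nat.one_le_iff_ne_zero.2 (Finsupp.mem_support_iff.1 hi)) : Finsupp.single i 1 ≤ s)]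
    simp [Finsupp.weight_single]
  have h2 : m + δ = Finsupp.weight w (s - Finsupp.single i 1) + (w i + δ) := by
    rw [← h1, add_assoc]
  rw [h2]
  exact (isWeightedHomogeneous_monomial w _ _ rfl).mul (hg i)

theorem weightedHomogeneousComponent_mkDerivation {g : σ → MvPolynomial σ R} {δ : M}
    (hg : ∀ i, IsWeightedHomogeneous w (g i) (w i + δ)) (p : MvPolynomial σ R) (m : M) :
    weightedHomogeneousComponent w (m + δ) (mkDerivation R g p) =
      mkDerivation R g (weightedHomogeneousComponent w m p) := by
  classical
  induction p using MvPolynomial.induction_on' with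
  | add p q hp hq => simp only [map_add, hp, hq]
  | monomial s r =>
    have hs := isWeightedHomogeneous_monomial w s r rfl
    rw [weightedHomogeneousComponent_of_mem (isWeightedHomogeneous_mkDerivation hg hs),
      weightedHomogeneousComponent_of_mem hs]
    simp only [add_left_inj]
    split_ifs <;> simp

end WeightedDerivation

section Seminvariants

open MvPolynomial

variable {d : ℕ}

/-- The torus weight of the variable `x_i` of the binary `d`-form. -/
def torusWeight (d : ℕ) (i : Fin (d + 1)) : ℤ := d - 2 * i.val

/-- The lowering derivation, opposite to `D1 d`. -/
def lowering (d : ℕ) :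
    Derivation ℂ (MvPolynomial (Fin (d + 1)) ℂ) (MvPolynomial (Fin (d + 1)) ℂ) :=
  mkDerivation ℂ (fun i => ((d : ℂ) - i.val) • X (i + 1))

/-- The derivation acting on monomials by their torus weight. -/
def torusDerivation (d : ℕ) :
    Derivation ℂ (MvPolynomial (Fin (d + 1)) ℂ) (MvPolynomial (Fin (d + 1)) ℂ) :=
  mkDerivation ℂ (fun i => (torusWeight d i : ℂ) • X i)

theorem val_sub_one_of_ne_zero {i : Fin (d + 1)} (hi : i.val ≠ 0) :
    (i - 1).val = i.val - 1 :=
  Fin.val_sub_one_of_ne_zero (fun h => hi (by simp [h]))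

theorem val_add_one_of_ne {i : Fin (d + 1)} (hi : i.val ≠ d) : (i + 1).val = i.val + 1 :=
  Fin.val_add_one_of_lt (Fin.lt_last_iff_ne_last.2 (fun h => hi (by simp [h])))

theorem D1_lowering (p : MvPolynomial (Fin (d + 1)) ℂ) :
    D1 d (lowering d p) = lowering d (D1 d p) + torusDerivation d p := by
  have key : ⁅D1 d, lowering d⁆ = torusDerivation d := by
    refine derivation_ext fun i => ?_
    rw [Derivation.commutator_apply]
    simp only [D1, lowering, torusDerivation, torusWeight, mkDerivation_X, Derivation.map_smul, smul_smul,
      sub_add_cancel, add_sub_cancel_right, ← sub_smul]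
    congr 1
    rcases eq_or_ne i.val 0 with h0 | h0 <;> rcases eq_or_ne i.val d with hd | hd
    · simp [← hd, h0]
    · simp [val_add_one_of_ne hd, h0]
    · rw [val_sub_one_of_ne_zero h0, Nat.cast_sub (by omega)]
      push_cast
      rw [hd]; ring
    · rw [val_sub_one_of_ne_zero h0, Nat.cast_sub (by omega), val_add_one_of_ne hd]
      push_cast
      ring
  rw [← key, Derivation.commutator_apply, add_sub_cancel]

theorem isWeightedHomogeneous_smul_X_sub_one (i : Fin (d + 1)) :
    IsWeightedHomogeneous (torusWeight d) ((i.val : ℂ) • X (i - 1) : MvPolynomial (Fin (d + 1)) ℂ)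
      (torusWeight d i + 2) := by
  rcases eq_or_ne i.val 0 with h0 | h0
  · simpa [h0] using isWeightedHomogeneous_zero ℂ (torusWeight d) _
  · have := isWeightedHomogeneous_X ℂ (torusWeight d) (i - 1)
    have h : torusWeight d (i - 1) = torusWeight d i + 2 := by
      simp only [torusWeight, val_sub_one_of_ne_zero h0]; omega
    rw [h] at this
    exact Submodule.smul_mem (weightedHomogeneousSubmodule ℂ (torusWeight d) _) _ this

theorem isWeightedHomogeneous_smul_X_add_one (i : Fin (d + 1)) :
    IsWeightedHomogeneous (torusWeight d)
      (((d : ℂ) - i.val) • X (i + 1) : MvPolynomial (Fin (d + 1)) ℂ)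
      (torusWeight d i + -2) := by
  rcases eq_or_ne i.val d with h0 | h0
  · simpa [h0] using isWeightedHomogeneous_zero ℂ (torusWeight d) _
  · have := isWeightedHomogeneous_X ℂ (torusWeight d) (i + 1)
    have h : torusWeight d (i + 1) = torusWeight d i + -2 := by
      simp only [torusWeight, val_add_one_of_ne h0]; omega
    rw [h] at this
    exact Submodule.smul_mem (weightedHomogeneousSubmodule ℂ (torusWeight d) _) _ this

theorem isHomogeneous_mkDerivation {c : Fin (d + 1) → ℂ} {g : Fin (d + 1) → Fin (d + 1)}
    {p : MvPolynomial (Fin (d + 1)) ℂ} {n : ℕ} (hp : p.IsHomogeneous n) :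
    (mkDerivation ℂ (fun i => c i • (X (g i) : MvPolynomial (Fin (d + 1)) ℂ)) p).IsHomogeneous n := by
  classical
  rw [p.as_sum, map_sum]
  refine (homogeneousSubmodule _ ℂ n).sum_mem fun s hs => ?_
  rw [mkDerivation_monomial]
  refine Submodule.smul_mem _ _ (Submodule.sum_mem _ fun i hi => ?_)
  have h1 : (s - Finsupp.single i 1).degree + 1 = n := by
    have h2 := hp (mem_support_iff.1 hs)
    rw [Pi.one_def, ← Finsupp.degree_eq_weight_one] at h2
    rw [← h2]
    conv_rhs => rw [← tsub_add_cancel_of_le (Finsupp.single_le_iff.2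
      (Nat.one_le_iff_ne_zero.2 (Finsupp.mem_support_iff.1 hi)) : Finsupp.single i 1 ≤ s)]
    simp
  rw [← h1]
  exact (isHomogeneous_monomial _ rfl).mul
    (Submodule.smul_mem (homogeneousSubmodule _ ℂ 1) _ (isHomogeneous_X _ _))

/-- The polynomials that are homogeneous of degree `n` and of torus weight `μ`. -/
def weightSpace (d n : ℕ) (μ : ℤ) : Submodule ℂ (MvPolynomial (Fin (d + 1)) ℂ) :=
  homogeneousSubmodule (Fin (d + 1)) ℂ n ⊓ weightedHomogeneousSubmodule ℂ (torusWeight d) μ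

variable {n : ℕ} {μ : ℤ} {p : MvPolynomial (Fin (d + 1)) ℂ}

theorem D1_mem_weightSpace (hp : p ∈ weightSpace d n μ) : D1 d p ∈ weightSpace d n (μ + 2) :=
  ⟨isHomogeneous_mkDerivation hp.1,
    isWeightedHomogeneous_mkDerivation isWeightedHomogeneous_smul_X_sub_one hp.2⟩

theorem lowering_mem_weightSpace (hp : p ∈ weightSpace d n μ) :
    lowering d p ∈ weightSpace d n (μ + -2) :=
  ⟨isHomogeneous_mkDerivation hp.1,
    isWeightedHomogeneous_mkDerivation isWeightedHomogeneous_smul_X_add_one hp.2⟩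

theorem torusDerivation_apply (hp : p.IsWeightedHomogeneous (torusWeight d) μ) :
    torusDerivation d p = (μ : ℂ) • p := by
  classical
  conv_lhs => rw [p.as_sum]
  conv_rhs => rw [p.as_sum]
  rw [map_sum, Finset.smul_sum]
  refine Finset.sum_congr rfl fun s hs => ?_
  rw [torusDerivation, mkDerivation_monomial, ← hp (mem_support_iff.1 hs),
    Finsupp.weight_apply, Finsupp.sum, Finsupp.sum, Int.cast_sum, Finset.sum_smul, Finset.smul_sum]
  refine Finset.sum_congr rfl fun i hi => ?_
  rw [smul_comm, smul_eq_mul, smul_eq_C_mul, X, smul_eq_C_mul, C_mul_monomial, C_mul_monomial,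
    monomial_mul, tsub_add_cancel_of_le (Finsupp.single_le_iff.2
      (Nat.one_le_iff_ne_zero.2 (Finsupp.mem_support_iff.1 hi)) : Finsupp.single i 1 ≤ s),
    smul_eq_C_mul, C_mul_monomial]
  congr 1
  simp
  ring

theorem abs_torusWeight_le (s : Fin (d + 1) →₀ ℕ) :
    |Finsupp.weight (torusWeight d) s| ≤ d * s.degree := by
  rw [Finsupp.weight_apply, Finsupp.sum, Finsupp.degree_apply, Nat.cast_sum, Finset.mul_sum]
  refine (Finset.abs_sum_le_sum_abs _ _).trans (Finset.sum_le_sum fun i _ => ?_)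
  rw [nsmul_eq_mul, abs_mul, Nat.abs_cast, mul_comm]
  refine mul_le_mul_of_nonneg_right ?_ (Nat.cast_nonneg _)
  rw [abs_le, torusWeight]
  have := i.is_le
  constructor <;> omega

theorem eq_zero_of_mem_weightSpace (hp : p ∈ weightSpace d n μ) (hμ : d * n < |μ|) : p = 0 := by
  ext s
  by_contra hs
  rw [coeff_zero] at hs
  have h1 := hp.1 hs
  have h2 : Finsupp.weight (torusWeight d) s = μ := hp.2 hs
  rw [Pi.one_def, ← Finsupp.degree_eq_weight_one] at h1
  have := abs_torusWeight_le s
  rw [h1, h2] at this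
  omega

theorem D1_pow_mem_weightSpace (hp : p ∈ weightSpace d n μ) (N : ℕ) :
    ((D1 d).toLinearMap ^ N) p ∈ weightSpace d n (μ + 2 * N) := by
  induction N with
  | zero => simpa using hp
  | succ N ih =>
    rw [pow_succ', Module.End.mul_apply]
    have h := D1_mem_weightSpace ih
    rwa [add_assoc, show (2 * N + 2 : ℤ) = 2 * (N + 1 : ℕ) by push_cast; ring] at h

theorem lowering_pow_mem_weightSpace (hp : p ∈ weightSpace d n μ) (N : ℕ) :
    ((lowering d).toLinearMap ^ N) p ∈ weightSpace d n (μ + -2 * N) := by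
  induction N with
  | zero => simpa using hp
  | succ N ih =>
    rw [pow_succ', Module.End.mul_apply]
    have h := lowering_mem_weightSpace ih
    rwa [add_assoc, show (-2 * N + -2 : ℤ) = -2 * (N + 1 : ℕ) by push_cast; ring] at h

theorem torusDerivation_D1 (p : MvPolynomial (Fin (d + 1)) ℂ) :
    torusDerivation d (D1 d p) = D1 d (torusDerivation d p) + (2 : ℂ) • D1 d p := by
  have key : ⁅torusDerivation d, D1 d⁆ = (2 : ℂ) • D1 d := by
    refine derivation_ext fun i => ?_
    have h : D1 d (X i) = (i.val : ℂ) • X (i - 1) := mkDerivation_X _ _ _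
    have h' : torusDerivation d (X i) = (torusWeight d i : ℂ) • X i := mkDerivation_X _ _ _
    rw [Derivation.commutator_apply, h', Derivation.map_smul, h,
      torusDerivation_apply (isWeightedHomogeneous_smul_X_sub_one i), Derivation.smul_apply, h,
      ← sub_smul]
    congr 1
    push_cast
    ring
  rw [← sub_eq_iff_eq_add', ← Derivation.commutator_apply, key, Derivation.smul_apply]

theorem torusDerivation_lowering (p : MvPolynomial (Fin (d + 1)) ℂ) :
    torusDerivation d (lowering d p) =
      lowering d (torusDerivation d p) - (2 : ℂ) • lowering d p := by
  have key : ⁅torusDerivation d, lowering d⁆ = (-2 : ℂ) • lowering d := by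
    refine derivation_ext fun i => ?_
    have h : lowering d (X i) = ((d : ℂ) - i.val) • X (i + 1) := mkDerivation_X _ _ _
    have h' : torusDerivation d (X i) = (torusWeight d i : ℂ) • X i := mkDerivation_X _ _ _
    rw [Derivation.commutator_apply, h', Derivation.map_smul, h,
      torusDerivation_apply (isWeightedHomogeneous_smul_X_add_one i), Derivation.smul_apply, h,
      ← sub_smul]
    congr 1
    push_cast
    ring
  rw [sub_eq_add_neg, ← neg_smul, ← sub_eq_iff_eq_add', ← Derivation.commutator_apply, key,
    Derivation.smul_apply]

theorem eq_zero_of_D1_eq_zero (hμ : μ < 0) (hp : p ∈ weightSpace d n μ) (h : D1 d p = 0) :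
    p = 0 := by
  refine eq_zero_of_pow_apply_eq_zero (e := (lowering d).toLinearMap) (f := (D1 d).toLinearMap)
    (h := -(torusDerivation d).toLinearMap) (μ := ((-μ : ℤ) : ℂ)) (N := d * n + 1)
    (fun v => ?_) (fun v => ?_) (fun N => ?_) ?_ h ?_
  · simp [D1_lowering v]
  · simp [torusDerivation_lowering v]; abel
  · exact_mod_cast (by omega : -μ + (N : ℤ) ≠ 0)
  · simp [torusDerivation_apply hp.2]
  · refine eq_zero_of_mem_weightSpace (lowering_pow_mem_weightSpace hp _) ?_
    rw [lt_abs]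
    right
    push_cast
    have : (0 : ℤ) ≤ d * n := by positivity
    linarith

theorem exists_D1_eq (hμ : 0 < μ) (hp : p ∈ weightSpace d n μ) :
    ∃ q ∈ weightSpace d n (μ - 2), D1 d q = p := by
  obtain ⟨u, hu, hup⟩ := exists_apply_apply_eq_of_pow_apply_eq_zero
    (e := (D1 d).toLinearMap) (f := (lowering d).toLinearMap)
    (h := (torusDerivation d).toLinearMap) (μ := (μ : ℂ)) (P := weightSpace d n μ)
    (N := d * n + 1) D1_lowering torusDerivation_D1
    (fun N => by exact_mod_cast (by omega : μ + (N : ℤ) ≠ 0))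
    (fun v hv => torusDerivation_apply hv.2)
    (fun v hv => by simpa using D1_mem_weightSpace (lowering_mem_weightSpace hv)) hp (by
      refine eq_zero_of_mem_weightSpace (D1_pow_mem_weightSpace hp _) ?_
      rw [lt_abs]
      left
      push_cast
      have : (0 : ℤ) ≤ d * n := by positivity
      linarith)
  exact ⟨_, lowering_mem_weightSpace hu, hup⟩

/-- The exponents of degree `n` and torus weight at least `t`. -/
def exponentsGE (d n : ℕ) (t : ℤ) : Finset (Fin (d + 1) →₀ ℕ) :=
  {s ∈ Finset.finsuppAntidiag Finset.univ n | t ≤ Finsupp.weight (torusWeight d) s}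

theorem mem_finsuppAntidiag_univ_iff {s : Fin (d + 1) →₀ ℕ} :
    s ∈ Finset.finsuppAntidiag Finset.univ n ↔ s.degree = n := by
  simp [Finset.mem_finsuppAntidiag, Finsupp.degree_eq_sum]

theorem weightSpace_le_restrictSupport {t : ℤ} (h : t ≤ μ) :
    weightSpace d n μ ≤ restrictSupport ℂ (exponentsGE d n t : Set (Fin (d + 1) →₀ ℕ)) := by
  intro p hp
  rw [mem_restrictSupport_iff]
  intro s hs
  have hs := mem_support_iff.1 hs
  have h1 := hp.1 hs
  have h2 : Finsupp.weight (torusWeight d) s = μ := hp.2 hs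
  rw [Pi.one_def, ← Finsupp.degree_eq_weight_one] at h1
  simp only [exponentsGE, Finset.coe_filter, Set.mem_ofPred_eq, mem_finsuppAntidiag_univ_iff]
  exact ⟨h1, h.trans_eq h2.symm⟩

theorem monomial_mem_weightSpace {s : Fin (d + 1) →₀ ℕ} (hs : s.degree = n) (c : ℂ) :
    monomial s c ∈ weightSpace d n (Finsupp.weight (torusWeight d) s) :=
  ⟨isHomogeneous_monomial _ hs, isWeightedHomogeneous_monomial _ _ _ rfl⟩

theorem map_D1_restrictSupport :
    (restrictSupport ℂ (exponentsGE d n 0 : Set (Fin (d + 1) →₀ ℕ))).map (D1 d).toLinearMap =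
      restrictSupport ℂ (exponentsGE d n 2 : Set (Fin (d + 1) →₀ ℕ)) := by
  apply le_antisymm
  · rw [restrictSupport_eq_span, Submodule.map_span_le]
    rintro _ ⟨s, hs, rfl⟩
    simp only [exponentsGE, Finset.coe_filter, Set.mem_ofPred_eq, mem_finsuppAntidiag_univ_iff] at hs
    exact weightSpace_le_restrictSupport (by linarith)
      (D1_mem_weightSpace (monomial_mem_weightSpace hs.1 1))
  · rw [restrictSupport_eq_span (R := ℂ) (exponentsGE d n 2 : Set (Fin (d + 1) →₀ ℕ)),
      Submodule.span_le]
    rintro _ ⟨s, hs, rfl⟩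
    simp only [exponentsGE, Finset.coe_filter, Set.mem_ofPred_eq, mem_finsuppAntidiag_univ_iff] at hs
    obtain ⟨q, hq, h⟩ := exists_D1_eq (by linarith) (monomial_mem_weightSpace hs.1 1)
    exact ⟨q, weightSpace_le_restrictSupport (by linarith) hq, h⟩

theorem Sn_le_restrictSupport :
    Sn d n ≤ restrictSupport ℂ (exponentsGE d n 0 : Set (Fin (d + 1) →₀ ℕ)) := by
  classical
  rintro p ⟨hp, hDp⟩
  rw [mem_restrictSupport_iff]
  intro s hs
  have hs := mem_support_iff.1 hs
  have h1 := hp hs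
  rw [Pi.one_def, ← Finsupp.degree_eq_weight_one] at h1
  simp only [exponentsGE, Finset.coe_filter, Set.mem_ofPred_eq, mem_finsuppAntidiag_univ_iff]
  refine ⟨h1, ?_⟩
  by_contra! hneg
  set μ := Finsupp.weight (torusWeight d) s with hμ
  have hmem : weightedHomogeneousComponent (torusWeight d) μ p ∈ weightSpace d n μ := by
    refine ⟨fun t ht => hp (fun h0 => ht ?_), weightedHomogeneousComponent_mem _ _ _⟩
    rw [coeff_weightedHomogeneousComponent, h0, ite_self]
  have hD : D1 d (weightedHomogeneousComponent (torusWeight d) μ p) = 0 := by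
    have := weightedHomogeneousComponent_mkDerivation
      (isWeightedHomogeneous_smul_X_sub_one (d := d)) p μ
    rw [D1, ← this]
    have h0 : D1 d p = 0 := hDp
    rw [D1] at h0
    rw [h0, map_zero]
  have h0 := congrArg (coeff s) (eq_zero_of_D1_eq_zero hneg hmem hD)
  rw [coeff_weightedHomogeneousComponent, if_pos hμ.symm, coeff_zero] at h0
  exact hs h0

theorem finrank_restrictSupport (s : Finset (Fin (d + 1) →₀ ℕ)) :
    Module.finrank ℂ (restrictSupport ℂ (s : Set (Fin (d + 1) →₀ ℕ))) = s.card := by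
  rw [Module.finrank_eq_card_basis (basisRestrictSupport ℂ (s : Set (Fin (d + 1) →₀ ℕ)))]
  simp

/-- The dimension of the space of seminvariants of degree `n` is the number of monomials of
degree `n` whose torus weight is `0` or `1`. -/
theorem finrank_Sn (d n : ℕ) :
    Module.finrank ℂ (Sn d n) = Finset.card
      {s ∈ Finset.finsuppAntidiag (Finset.univ : Finset (Fin (d + 1))) n |
        Finsupp.weight (torusWeight d) s = 0 ∨ Finsupp.weight (torusWeight d) s = 1} := by
  set U := restrictSupport ℂ (exponentsGE d n 0 : Set (Fin (d + 1) →₀ ℕ)) with hU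
  have : Module.Finite ℂ U := Module.Finite.of_basis (basisRestrictSupport ℂ _)
  have hrank := LinearMap.finrank_range_add_finrank_ker ((D1 d).toLinearMap.domRestrict U)
  have hSn : Sn d n = (LinearMap.ker ((D1 d).toLinearMap.domRestrict U)).map U.subtype := by
    ext p
    constructor
    · intro hp
      exact ⟨⟨p, Sn_le_restrictSupport hp⟩, hp.2, rfl⟩
    · rintro ⟨⟨q, hq⟩, hq', rfl⟩
      refine ⟨fun s hs => ?_, hq'⟩
      have := (mem_restrictSupport_iff ℂ).1 hq (mem_support_iff.2 hs)
      simp only [exponentsGE, Finset.coe_filter, Set.mem_ofPred_eq,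
        mem_finsuppAntidiag_univ_iff] at this
      rw [Pi.one_def, ← Finsupp.degree_eq_weight_one]
      exact this.1
  rw [LinearMap.range_domRestrict, hU, map_D1_restrictSupport, finrank_restrictSupport,
    finrank_restrictSupport, ← hU, ← Submodule.finrank_map_subtype_eq, ← hSn] at hrank
  have hsub : exponentsGE d n 2 ⊆ exponentsGE d n 0 :=
    Finset.monotone_filter_right _ fun s _ hs => by linarith
  have hcard := Finset.card_sdiff_add_card_eq_card hsub
  have hset : exponentsGE d n 0 \ exponentsGE d n 2 =
      {s ∈ Finset.finsuppAntidiag (Finset.univ : Finset (Fin (d + 1))) n |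
        Finsupp.weight (torusWeight d) s = 0 ∨ Finsupp.weight (torusWeight d) s = 1} := by
    ext s
    simp only [exponentsGE, Finset.mem_sdiff, Finset.mem_filter]
    constructor
    · rintro ⟨⟨h1, h2⟩, h3⟩
      refine ⟨h1, ?_⟩
      have : ¬ 2 ≤ Finsupp.weight (torusWeight d) s := fun h => h3 ⟨h1, h⟩
      omega
    · rintro ⟨h1, h2⟩
      refine ⟨⟨h1, by omega⟩, fun h => ?_⟩
      have := h.2
      omega
  rw [← hset]
  omega

end Seminvariants

section PartialFractions

/-- The numerator of the Poincaré series of the covariants of the binary quintic. -/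
def poincareNumerator {S : Type*} [CommRing S] (z : S) : S :=
  1 + z ^ 2 + 3 * z ^ 3 + 3 * z ^ 4 + 5 * z ^ 5 + 4 * z ^ 6 + 6 * z ^ 7 + 6 * z ^ 8 + 4 * z ^ 9 +
    5 * z ^ 10 + 3 * z ^ 11 + 3 * z ^ 12 + z ^ 13 + z ^ 15

/-- The denominator of the Poincaré series of the covariants of the binary quintic. -/
def poincareDenominator {S : Type*} [CommRing S] (z : S) : S :=
  (1 - z) * (1 - z ^ 2) * (1 - z ^ 4) * (1 - z ^ 6) * (1 - z ^ 8)

/-- The product of the factors `1 - u ^ k * z` over the odd `k ≤ 5`. -/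
def halfDenominator {S : Type*} [CommRing S] (u z : S) : S :=
  (1 - u * z) * (1 - u ^ 3 * z) * (1 - u ^ 5 * z)

/-- The numerator, up to a factor `u`, of the part of the partial fraction decomposition with
positive powers of the torus variable `u`. -/
def positiveNumerator {S : Type*} [CommRing S] (u z : S) : S :=
    (z + 2 * z ^ 2 + 2 * z ^ 3 + 3 * z ^ 4 + 5 * z ^ 5 + 5 * z ^ 6 + 5 * z ^ 7 + 5 * z ^ 8 + 5 *
      z ^ 9 + 5 * z ^ 10 + 3 * z ^ 11 + 2 * z ^ 12 + 2 * z ^ 13 + z ^ 14) +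
    (z + z ^ 2 + z ^ 4 + z ^ 5 + z ^ 6 + z ^ 9 - z ^ 10 - 2 * z ^ 11 - z ^ 12 - z ^ 14 - z ^ 15)
      * u +
    (z + z ^ 3 + 2 * z ^ 4 + z ^ 6 + z ^ 8 - 3 * z ^ 10 - z ^ 13 - z ^ 14 - z ^ 15) * u ^ 2 +
    (z - z ^ 2 - z ^ 3 - 4 * z ^ 5 - 3 * z ^ 6 - 4 * z ^ 7 - 5 * z ^ 8 - 6 * z ^ 9 - 7 * z ^ 10
      - 3 * z ^ 11 - 5 * z ^ 12 - 4 * z ^ 13 - 2 * z ^ 14 - 2 * z ^ 15) * u ^ 3 +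
    (z - z ^ 2 + z ^ 4 - z ^ 5 + 2 * z ^ 6 - z ^ 7 - z ^ 8 - z ^ 10 + z ^ 11 - z ^ 12 + z ^ 16)
      * u ^ 4 +
    (-z ^ 2 - z ^ 3 - 2 * z ^ 4 - 3 * z ^ 5 - 4 * z ^ 6 - 7 * z ^ 7 - 5 * z ^ 8 - 5 * z ^ 9 - 6
      * z ^ 10 - 4 * z ^ 11 - 4 * z ^ 12 - 2 * z ^ 13 - 2 * z ^ 14 - z ^ 15 + z ^ 16) * u ^ 5 +
    (-z ^ 2 - z ^ 5 - z ^ 6 - 2 * z ^ 7 + z ^ 8 - z ^ 9 - z ^ 10 + z ^ 11 + 2 * z ^ 13 + z ^ 15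
      + 2 * z ^ 16) * u ^ 6 +
    (-z ^ 2 + z ^ 3 - z ^ 4 - 2 * z ^ 5 - 2 * z ^ 7 + z ^ 8 - 2 * z ^ 9 + 2 * z ^ 11 - z ^ 12 +
      2 * z ^ 13 + 2 * z ^ 15 + z ^ 16 - z ^ 17 + z ^ 18) * u ^ 7 +
    (z ^ 3 + z ^ 5 + 3 * z ^ 6 + 3 * z ^ 7 + 5 * z ^ 8 + 4 * z ^ 9 + 6 * z ^ 10 + 6 * z ^ 11 + 4
      * z ^ 12 + 5 * z ^ 13 + 3 * z ^ 14 + 3 * z ^ 15 + z ^ 16 + z ^ 18) * u ^ 8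

/-- The numerator, up to a factor `u`, of the part of the partial fraction decomposition with
negative powers of the torus variable `u⁻¹`. -/
def negativeNumerator {S : Type*} [CommRing S] (u z : S) : S :=
    (1 + z ^ 2 + 3 * z ^ 3 + 3 * z ^ 4 + 5 * z ^ 5 + 4 * z ^ 6 + 6 * z ^ 7 + 6 * z ^ 8 + 4 * z ^
      9 + 5 * z ^ 10 + 3 * z ^ 11 + 3 * z ^ 12 + z ^ 13 + z ^ 15) +
    (2 * z ^ 2 + z ^ 3 + 2 * z ^ 5 + z ^ 7 - z ^ 8 - z ^ 9 + z ^ 10 - 2 * z ^ 11 - z ^ 12 - z ^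
      13 - z ^ 16) * u +
    (z + z ^ 2 + z ^ 4 + z ^ 5 + z ^ 6 + z ^ 9 - z ^ 10 - 2 * z ^ 11 - z ^ 12 - z ^ 14 - z ^ 15)
      * u ^ 2 +
    (-z ^ 4 - 3 * z ^ 5 - 4 * z ^ 6 - 4 * z ^ 7 - 5 * z ^ 8 - 6 * z ^ 9 - 7 * z ^ 10 - 5 * z ^
      11 - 3 * z ^ 12 - 4 * z ^ 13 - 2 * z ^ 14 - z ^ 15 - z ^ 16) * u ^ 3 +
    (z - z ^ 3 + z ^ 4 - z ^ 5 + z ^ 7 - z ^ 8 - z ^ 10 + z ^ 11 - z ^ 13 + z ^ 14 - z ^ 15 + z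
      ^ 17) * u ^ 4 +
    (-z ^ 2 - z ^ 3 - 2 * z ^ 4 - 4 * z ^ 5 - 3 * z ^ 6 - 5 * z ^ 7 - 7 * z ^ 8 - 6 * z ^ 9 - 5
      * z ^ 10 - 4 * z ^ 11 - 4 * z ^ 12 - 3 * z ^ 13 - z ^ 14) * u ^ 5 +
    (-z ^ 3 - z ^ 4 - z ^ 6 - 2 * z ^ 7 - z ^ 8 + z ^ 9 + z ^ 12 + z ^ 13 + z ^ 14 + z ^ 16 + z
      ^ 17) * u ^ 6 +
    (-z ^ 2 - z ^ 5 - z ^ 6 - 2 * z ^ 7 + z ^ 8 - z ^ 9 - z ^ 10 + z ^ 11 + 2 * z ^ 13 + z ^ 15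
      + 2 * z ^ 16) * u ^ 7 +
    (z ^ 3 + z ^ 5 + 3 * z ^ 6 + 3 * z ^ 7 + 5 * z ^ 8 + 4 * z ^ 9 + 6 * z ^ 10 + 6 * z ^ 11 + 4
      * z ^ 12 + 5 * z ^ 13 + 3 * z ^ 14 + 3 * z ^ 15 + z ^ 16 + z ^ 18) * u ^ 8

variable {S S' : Type*} [CommRing S] [CommRing S']

theorem map_poincareNumerator (φ : S →+* S') (z : S) :
    φ (poincareNumerator z) = poincareNumerator (φ z) := by
  simp only [poincareNumerator, map_add, map_mul, map_pow, map_one, map_ofNat]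

theorem map_poincareDenominator (φ : S →+* S') (z : S) :
    φ (poincareDenominator z) = poincareDenominator (φ z) := by
  simp only [poincareDenominator, map_sub, map_mul, map_pow, map_one]

theorem map_halfDenominator (φ : S →+* S') (u z : S) :
    φ (halfDenominator u z) = halfDenominator (φ u) (φ z) := by
  simp only [halfDenominator, map_sub, map_mul, map_pow, map_one]

theorem map_positiveNumerator (φ : S →+* S') (u z : S) :
    φ (positiveNumerator u z) = positiveNumerator (φ u) (φ z) := by
  simp only [positiveNumerator, map_add, map_sub, map_neg, map_mul, map_pow, map_ofNat]

theorem map_negativeNumerator (φ : S →+* S') (u z : S) :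
    φ (negativeNumerator u z) = negativeNumerator (φ u) (φ z) := by
  simp only [negativeNumerator, map_add, map_sub, map_neg, map_mul, map_pow, map_one, map_ofNat]

theorem mul_pow_eq_of_mul_eq_one {u v : S} (huv : u * v = 1) (b₁ b₂ b₃ b₄ b₅ b₆ b₇ b₈ b₉ : S) :
    u ^ 9 * (v * (b₁ + b₂ * v + b₃ * v ^ 2 + b₄ * v ^ 3 + b₅ * v ^ 4 + b₆ * v ^ 5 + b₇ * v ^ 6 +
      b₈ * v ^ 7 + b₉ * v ^ 8)) =
    b₁ * u ^ 8 + b₂ * u ^ 7 + b₃ * u ^ 6 + b₄ * u ^ 5 + b₅ * u ^ 4 + b₆ * u ^ 3 + b₇ * u ^ 2 +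
      b₈ * u + b₉ := by
  have h (k : ℕ) : u ^ k * v ^ k = 1 := by rw [← mul_pow, huv, one_pow]
  linear_combination b₁ * u ^ 8 * h 1 + b₂ * u ^ 7 * h 2 + b₃ * u ^ 6 * h 3 + b₄ * u ^ 5 * h 4 +
    b₅ * u ^ 4 * h 5 + b₆ * u ^ 3 * h 6 + b₇ * u ^ 2 * h 7 + b₈ * u * h 8 + b₉ * h 9

theorem pow_mul_halfDenominator {u v : S} (huv : u * v = 1) (z : S) :
    u ^ 9 * halfDenominator v z = (u - z) * (u ^ 3 - z) * (u ^ 5 - z) := by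
  have h (k : ℕ) : u ^ k * (1 - v ^ k * z) = u ^ k - z := by
    rw [mul_sub, ← mul_assoc, ← mul_pow, huv, one_pow, one_mul, mul_one]
  rw [← h 3, ← h 5, ← pow_one u, ← pow_one v, ← h 1, halfDenominator]
  ring

/-- The partial fraction decomposition with respect to the torus variable `u`, with the
denominators cleared. -/
theorem partialFractions {u v : S} (huv : u * v = 1) (z : S) :
    (1 + v) * poincareDenominator z =
      poincareNumerator z * (halfDenominator u z * halfDenominator v z) +
        u * positiveNumerator u z * halfDenominator v z +
        v * negativeNumerator v z * halfDenominator u z := by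
  have hu : IsUnit (u ^ 9) := (IsUnit.of_mul_eq_one _ huv).pow 9
  refine hu.mul_left_cancel ?_
  have hn := pow_mul_halfDenominator huv z
  have hv : u ^ 9 * (v * negativeNumerator v z) = _ := mul_pow_eq_of_mul_eq_one huv _ _ _ _ _ _ _ _ _
  have h1 : u ^ 9 * (1 + v) = u ^ 8 * (u + 1) := by linear_combination u ^ 8 * huv
  calc _ = u ^ 9 * (1 + v) * poincareDenominator z := by ring
    _ = poincareNumerator z * halfDenominator u z * (u ^ 9 * halfDenominator v z) +
        u * positiveNumerator u z * (u ^ 9 * halfDenominator v z) +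
        u ^ 9 * (v * negativeNumerator v z) * halfDenominator u z := by
      rw [h1, hn, hv, poincareDenominator, poincareNumerator, halfDenominator, positiveNumerator]
      ring
    _ = _ := by ring

end PartialFractions

section GeneratingFunction

open LaurentPolynomial

theorem PowerSeries.one_sub_C_mul_X_mul_mk_pow {S : Type*} [CommRing S] (c : S) :
    (1 - PowerSeries.C c * PowerSeries.X) * PowerSeries.mk (fun n => c ^ n) = 1 := by
  ext n
  cases n with
  | zero => simp
  | succ n => simp [sub_mul, mul_assoc, PowerSeries.coeff_succ_X_mul, pow_succ', PowerSeries.coeff_one]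

/-- The generating function of the monomials in `x_0, …, x_d`, where `z` records the degree and
`T` the torus weight. -/
def monomialSeries (d : ℕ) : PowerSeries ℂ[T;T⁻¹] :=
  ∏ i : Fin (d + 1), PowerSeries.mk fun n => T (torusWeight d i) ^ n

theorem coeff_monomialSeries (d n : ℕ) :
    PowerSeries.coeff n (monomialSeries d) =
      ∑ s ∈ Finset.finsuppAntidiag (Finset.univ : Finset (Fin (d + 1))) n,
        T (Finsupp.weight (torusWeight d) s) := by
  have hT (s : Fin (d + 1) →₀ ℕ) : (T (Finsupp.weight (torusWeight d) s) : ℂ[T;T⁻¹]) =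
      ∏ i, T (torusWeight d i) ^ s i := by
    rw [Finsupp.weight_apply, Finsupp.sum_fintype _ _ (by simp)]
    induction (Finset.univ : Finset (Fin (d + 1))) using Finset.cons_induction with
    | empty => simp
    | cons a t ha ih => rw [Finset.sum_cons, Finset.prod_cons, T_add, ih, T_pow, nsmul_eq_mul]
  rw [monomialSeries, PowerSeries.coeff_prod]
  simp only [PowerSeries.coeff_mk, hT]

theorem coeff_zero_coeff_one_add_mul_monomialSeries (d n : ℕ) :
    (PowerSeries.coeff n ((1 + PowerSeries.C (T (-1))) * monomialSeries d)).coeff 0 =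
      (Module.finrank ℂ (Sn d n) : ℂ) := by
  rw [finrank_Sn, add_mul, one_mul, map_add, PowerSeries.coeff_C_mul, coeff_monomialSeries,
    Finset.mul_sum, ← Finset.sum_add_distrib, AddMonoidAlgebra.coeff_sum, Finsupp.finsetSum_apply,
    Finset.natCast_card_filter]
  refine Finset.sum_congr rfl fun s _ => ?_
  rw [← T_add, AddMonoidAlgebra.coeff_add, Finsupp.add_apply, T_apply, T_apply]
  rcases eq_or_ne (Finsupp.weight (torusWeight d) s) 0 with h0 | h0
  · simp [h0]
  · rcases eq_or_ne (Finsupp.weight (torusWeight d) s) 1 with h1 | h1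
    · simp [h1]
    · simp [h0, h1, neg_add_eq_zero, h1.symm]

theorem coeff_zero_coeff_map_C_mul (g : PowerSeries ℂ) (G : PowerSeries ℂ[T;T⁻¹]) (n : ℕ) :
    (PowerSeries.coeff n (PowerSeries.map LaurentPolynomial.C g * G)).coeff 0 =
      PowerSeries.coeff n (g * PowerSeries.mk fun m => (PowerSeries.coeff m G).coeff 0) := by
  simp only [PowerSeries.coeff_mul, PowerSeries.coeff_map, PowerSeries.coeff_mk,
    AddMonoidAlgebra.coeff_sum, Finsupp.finsetSum_apply, ← LaurentPolynomial.smul_eq_C_mul,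
    AddMonoidAlgebra.coeff_smul_apply, smul_eq_mul]

theorem coeff_zero_coeff_map_toLaurent (G : PowerSeries (Polynomial ℂ)) (n : ℕ) :
    (PowerSeries.coeff n (PowerSeries.map Polynomial.toLaurent
      (PowerSeries.C Polynomial.X * G))).coeff 0 = 0 := by
  rw [PowerSeries.coeff_map, PowerSeries.coeff_C_mul, mul_comm, map_mul, Polynomial.toLaurent_X]
  have h := LaurentPolynomial.coeff_toLaurent (PowerSeries.coeff n G)
  rw [T, AddMonoidAlgebra.coeff_mul_single_apply, h, mul_one, zero_add]
  refine Finsupp.mapDomain_of_notMem_range _ _ ?_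
  rintro ⟨k, hk⟩
  simp at hk

theorem coeff_zero_invert (f : ℂ[T;T⁻¹]) : (invert f).coeff 0 = f.coeff 0 := by
  simp

theorem isUnit_halfDenominator {S : Type*} [CommRing S] (c : S) :
    IsUnit (halfDenominator (PowerSeries.C c) PowerSeries.X) := by
  rw [PowerSeries.isUnit_iff_constantCoeff, map_halfDenominator, PowerSeries.constantCoeff_X]
  simp [halfDenominator]

theorem halfDenominator_mul_monomialSeries :
    halfDenominator (PowerSeries.C (T 1)) PowerSeries.X *
      halfDenominator (PowerSeries.C (T (-1))) PowerSeries.X * monomialSeries 5 = 1 := by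
  have h (k : ℤ) := PowerSeries.one_sub_C_mul_X_mul_mk_pow (T k : ℂ[T;T⁻¹])
  have hw : torusWeight 5 0 = 5 ∧ torusWeight 5 1 = 3 ∧ torusWeight 5 2 = 1 ∧
      torusWeight 5 3 = -1 ∧ torusWeight 5 4 = -3 ∧ torusWeight 5 5 = -5 := by
    decide
  obtain ⟨h0, h1, h2, h3, h4, h5⟩ := hw
  rw [monomialSeries, Fin.prod_univ_six, h0, h1, h2, h3, h4, h5]
  have e1 : PowerSeries.C (T 1 : ℂ[T;T⁻¹]) ^ 3 = PowerSeries.C (T 3) := by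
    rw [← map_pow, T_pow]; norm_num
  have e2 : PowerSeries.C (T 1 : ℂ[T;T⁻¹]) ^ 5 = PowerSeries.C (T 5) := by
    rw [← map_pow, T_pow]; norm_num
  have e3 : PowerSeries.C (T (-1) : ℂ[T;T⁻¹]) ^ 3 = PowerSeries.C (T (-3)) := by
    rw [← map_pow, T_pow]; norm_num
  have e4 : PowerSeries.C (T (-1) : ℂ[T;T⁻¹]) ^ 5 = PowerSeries.C (T (-5)) := by
    rw [← map_pow, T_pow]; norm_num
  rw [halfDenominator, halfDenominator, e1, e2, e3, e4]
  let f (k : ℤ) : PowerSeries ℂ[T;T⁻¹] :=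
    (1 - PowerSeries.C (T k) * PowerSeries.X) * PowerSeries.mk fun n => T k ^ n
  calc _ = f 5 * f 3 * f 1 * f (-1) * f (-3) * f (-5) := by ring
    _ = 1 := by simp only [f, h, mul_one]

theorem poincareDenominator_mul_PSeries :
    poincareDenominator PowerSeries.X * PSeries 5 = poincareNumerator PowerSeries.X := by
  set u : PowerSeries ℂ[T;T⁻¹] := PowerSeries.C (T 1) with hu
  set v : PowerSeries ℂ[T;T⁻¹] := PowerSeries.C (T (-1)) with hv
  have huv : u * v = 1 := by rw [hu, hv, ← map_mul, ← T_add]; simp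
  obtain ⟨E, hE⟩ := (isUnit_halfDenominator (Polynomial.X : Polynomial ℂ)).exists_right_inv
  set φ := PowerSeries.map (Polynomial.toLaurent : Polynomial ℂ →+* ℂ[T;T⁻¹]) with hφ
  set ψ := (PowerSeries.map (invert : ℂ[T;T⁻¹] ≃ₐ[ℂ] ℂ[T;T⁻¹]).toRingHom).comp φ with hψ
  have hφu : φ (PowerSeries.C Polynomial.X) = u := by simp [hφ, hu]
  have hφX : φ PowerSeries.X = PowerSeries.X := by simp [hφ]
  have hψv : ψ (PowerSeries.C Polynomial.X) = v := by
    rw [hψ, RingHom.comp_apply, hφu]; simp [hu, hv]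
  have hψX : ψ PowerSeries.X = PowerSeries.X := by rw [hψ, RingHom.comp_apply, hφX]; simp
  have hφE := congrArg φ hE
  have hψE := congrArg ψ hE
  rw [map_mul, map_halfDenominator, map_one, hφu, hφX] at hφE
  rw [map_mul, map_halfDenominator, map_one, hψv, hψX] at hψE
  have hM : monomialSeries 5 = φ E * ψ E := by
    have h := halfDenominator_mul_monomialSeries
    rw [← hu, ← hv] at h
    linear_combination φ E * ψ E * h - monomialSeries 5 * ψ E * halfDenominator v PowerSeries.X * hφE
      - monomialSeries 5 * hψE
  have key : poincareDenominator PowerSeries.X * ((1 + v) * monomialSeries 5) =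
      poincareNumerator PowerSeries.X +
      φ (PowerSeries.C Polynomial.X *
        (positiveNumerator (PowerSeries.C Polynomial.X) PowerSeries.X * E)) +
      ψ (PowerSeries.C Polynomial.X *
        (negativeNumerator (PowerSeries.C Polynomial.X) PowerSeries.X * E)) := by
    rw [map_mul, map_mul, map_mul, map_mul, map_positiveNumerator, map_negativeNumerator, hφu, hφX,
      hψv, hψX, hM]
    have h := partialFractions huv PowerSeries.X
    generalize poincareDenominator (PowerSeries.X : PowerSeries ℂ[T;T⁻¹]) = Q at *
    generalize poincareNumerator (PowerSeries.X : PowerSeries ℂ[T;T⁻¹]) = P at *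
    generalize positiveNumerator u PowerSeries.X = A at *
    generalize negativeNumerator v PowerSeries.X = B at *
    generalize halfDenominator u PowerSeries.X = a at *
    generalize halfDenominator v PowerSeries.X = b at *
    generalize φ E = e at *
    generalize ψ E = e' at *
    linear_combination e * e' * h + (P * b * e' + v * B * e') * hφE + (P + u * A * e) * hψE
  have hX : PowerSeries.map (LaurentPolynomial.C : ℂ →+* ℂ[T;T⁻¹]) PowerSeries.X = PowerSeries.X :=
    PowerSeries.map_X _
  have hP : PSeries 5 = PowerSeries.mk fun m =>
      (PowerSeries.coeff m ((1 + v) * monomialSeries 5)).coeff 0 := by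
    rw [PSeries]
    congr 1
    ext m
    rw [hv, coeff_zero_coeff_one_add_mul_monomialSeries]
  ext n
  rw [hP, ← coeff_zero_coeff_map_C_mul, map_poincareDenominator, hX, key, map_add, map_add,
    AddMonoidAlgebra.coeff_add, AddMonoidAlgebra.coeff_add, Finsupp.add_apply, Finsupp.add_apply,
    hψ, RingHom.comp_apply, PowerSeries.coeff_map _ n (φ _), hφ, coeff_zero_coeff_map_toLaurent]
  have hinv (f : ℂ[T;T⁻¹]) :
      ((invert : ℂ[T;T⁻¹] ≃ₐ[ℂ] ℂ[T;T⁻¹]).toRingHom f).coeff 0 = f.coeff 0 :=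
    coeff_zero_invert f
  rw [hinv, coeff_zero_coeff_map_toLaurent, ← hX, ← map_poincareNumerator, PowerSeries.coeff_map]
  simp

end GeneratingFunction

/-- The Poincaré series of the algebra of covariants of the binary 5-form. -/
theorem poincare_series_d5 :
    PSeries 5 = (1 + (PowerSeries.X : PowerSeries ℂ) ^ 2 + 3 * (PowerSeries.X : PowerSeries ℂ) ^ 3 + 3 * (PowerSeries.X : PowerSeries ℂ) ^ 4 + 5 * (PowerSeries.X : PowerSeries ℂ) ^ 5 + 4 * (PowerSeries.X : PowerSeries ℂ) ^ 6 + 6 * (PowerSeries.X : PowerSeries ℂ) ^ 7 + 6 * (PowerSeries.X : PowerSeries ℂ) ^ 8 + 4 * (PowerSeries.X : PowerSeries ℂ) ^ 9 + 5 * (PowerSeries.X : PowerSeries ℂ) ^ 10 + 3 * (PowerSeries.X : PowerSeries ℂ) ^ 11 + 3 * (PowerSeries.X : PowerSeries ℂ) ^ 12 + (PowerSeries.X : PowerSeries ℂ) ^ 13 + (PowerSeries.X : PowerSeries ℂ) ^ 15) * ((1 - (PowerSeries.X : PowerSeries ℂ)) * (1 - (PowerSeries.X : PowerSeries ℂ)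 ^ 2) * (1 - (PowerSeries.X : PowerSeries ℂ) ^ 4) * (1 - (PowerSeries.X : PowerSeries ℂ) ^ 6) * (1 - (PowerSeries.X : PowerSeries ℂ) ^ 8))⁻¹ := by
  rw [PowerSeries.eq_mul_inv_iff_mul_eq (by simp), mul_comm]
  exact poincareDenominator_mul_PSeries

end
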